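/- Fix an integer m ≥ 1 and a measurable g : [0,∞) → [0,∞]. Setting y₁ := (0,0) ∈ ℝ², the iterated Lebesgue integral over (y₂, y₃, …, y_{2m+2}) ∈ (ℝ²)^{2m+1} of the function ∏_{i=1}^{m+1} g(|y_{2i} − y_{2i−1}|) · ∏_{i=1}^{m} 1{ y_{2i+1} ∈ H⁺(y_{2i−1}, y_{2i}) and [y_{2i+1}, y_{2i+2}] ∩ [y_{2i−1}, y_{2i}] ≠ ∅ } equals 2^{m+1} π ( ∫_0^∞ r² g(r) dr )² ( ∫_0^∞ r³ g(r) dr )^{m−1}. -/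

import Mathlib

open MeasureTheory Set Real
open scoped ENNReal Classical

/-- The open half-plane to the left of the directed line from `a` to `b`. -/
def Hplus (a b : EuclideanSpace ℝ (Fin 2)) : Set (EuclideanSpace ℝ (Fin 2)) :=
  {c | 0 < (b 0 - a 0) * (c 1 - a 1) - (b 1 - a 1) * (c 0 - a 0)}

/-- The Euclidean plane. -/
abbrev Plane := EuclideanSpace ℝ (Fin 2)

/-- The signed area spanned by two plane vectors. -/
noncomputable def signedArea (u : Plane) : Plane →ₗ[ℝ] ℝ where
  toFun v := u 0 * v 1 - u 1 * v 0
  map_add' v w := by simp; ring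
  map_smul' t v := by simp; ring

theorem signedArea_apply (u v : Plane) : signedArea u v = u 0 * v 1 - u 1 * v 0 := rfl

theorem signedArea_self (u : Plane) : signedArea u u = 0 := by
  rw [signedArea_apply]; ring

/-- The segment `[c, d]` starts to the left of the directed segment `[a, b]` and meets it. -/
def CrossesFromLeft (a b c d : Plane) : Prop :=
  c ∈ Hplus a b ∧ (segment ℝ c d ∩ segment ℝ a b).Nonempty

theorem mem_Hplus_iff (a b c : Plane) : c ∈ Hplus a b ↔ 0 < signedArea (b - a) (c - a) := by
  simp [Hplus, signedArea_apply]

theorem crossesFromLeft_add_iff (a b c w : Plane) :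
    CrossesFromLeft a b c (c + w) ↔
      c - a ∈ parallelepiped ![b - a, -w] ∩ {v | 0 < signedArea (b - a) v} := by
  rw [CrossesFromLeft, mem_Hplus_iff, mem_inter_iff, mem_ofPred_eq, and_comm,
    and_congr_left_iff]
  intro _
  rw [mem_parallelepiped_iff, segment_eq_image', segment_eq_image']
  constructor
  · rintro ⟨_, ⟨t, ht, rfl⟩, s, hs, h⟩
    refine ⟨![s, t], ⟨?_, ?_⟩, ?_⟩
    · intro i; fin_cases i <;> simp [hs.1, ht.1]
    · intro i; fin_cases i <;> simp [hs.2, ht.2]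
    · simp only [add_sub_cancel_left] at h
      simp only [Fin.sum_univ_two, Matrix.cons_val_zero, Matrix.cons_val_one]
      rw [sub_eq_iff_eq_add, add_right_comm, add_comm (s • _), h, smul_neg]
      abel
  · rintro ⟨t, ht, h⟩
    simp only [Fin.sum_univ_two, Matrix.cons_val_zero, Matrix.cons_val_one] at h
    refine ⟨c + t 1 • w, ⟨t 1, ⟨ht.1 1, ht.2 1⟩, by simp⟩, t 0, ⟨ht.1 0, ht.2 0⟩, ?_⟩
    rw [sub_eq_iff_eq_add] at h
    simp only [h, smul_neg]
    abel

theorem volume_parallelepiped_pair (u v : Plane) :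
    volume (parallelepiped ![u, v]) = ENNReal.ofReal |signedArea u v| := by
  rw [← (EuclideanSpace.basisFun (Fin 2) ℝ).addHaar_eq_volume, Measure.addHaar_parallelepiped,
    Module.Basis.det_apply, Matrix.det_fin_two]
  simp only [Module.Basis.toMatrix_apply, OrthonormalBasis.coe_toBasis_repr_apply,
    EuclideanSpace.basisFun_repr, Matrix.cons_val_zero, Matrix.cons_val_one, signedArea_apply]
  ring_nf

theorem volume_signedArea_eq_zero {u : Plane} (hu : u ≠ 0) :
    volume {v : Plane | signedArea u v = 0} = 0 := by
  refine Measure.addHaar_submodule volume (LinearMap.ker (signedArea u)) fun h => hu ?_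
  rw [LinearMap.ker_eq_top] at h
  have h₀ := LinearMap.congr_fun h !₂[0, 1]
  have h₁ := LinearMap.congr_fun h !₂[1, 0]
  simp only [signedArea_apply] at h₀ h₁
  ext i
  fin_cases i <;> simp_all

theorem signedArea_of_mem_parallelepiped {u w v : Plane} (hv : v ∈ parallelepiped ![u, -w]) :
    ∃ t : ℝ, 0 ≤ t ∧ signedArea u v = t * -signedArea u w := by
  obtain ⟨t, ht, rfl⟩ := (mem_parallelepiped_iff _ _).1 hv
  refine ⟨t 1, ht.1 1, ?_⟩
  simp [Fin.sum_univ_two, signedArea_self]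

theorem volume_crossesFromLeft (a b w : Plane) :
    volume {c | CrossesFromLeft a b c (c + w)} = ENNReal.ofReal (-signedArea (b - a) w) := by
  have hset : {c | CrossesFromLeft a b c (c + w)} = (fun c => c + -a) ⁻¹'
      (parallelepiped ![b - a, -w] ∩ {v | 0 < signedArea (b - a) v}) := by
    ext c
    simp only [mem_ofPred_eq, crossesFromLeft_add_iff, mem_preimage, sub_eq_add_neg]
  rw [hset, measure_preimage_add_right]
  generalize b - a = u
  rcases le_or_gt 0 (signedArea u w) with h | h
  · rw [ENNReal.ofReal_of_nonpos (by linarith)]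
    convert measure_empty (μ := (volume : Measure Plane))
    rw [eq_empty_iff_forall_notMem]
    rintro v ⟨hv, hpos⟩
    obtain ⟨t, ht, h'⟩ := signedArea_of_mem_parallelepiped hv
    have : 0 < signedArea u v := hpos
    nlinarith [mul_nonneg ht h]
  · have hu : u ≠ 0 := by
      rintro rfl
      simp [signedArea_apply] at h
    have hP : volume (parallelepiped ![u, -w]) = ENNReal.ofReal (-signedArea u w) := by
      rw [volume_parallelepiped_pair, map_neg, abs_of_pos (by linarith)]
    rw [← hP]
    refine measure_congr ?_
    have hnull : ∀ᵐ v : Plane, signedArea u v ≠ 0 := by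
      rw [ae_iff]
      simpa using volume_signedArea_eq_zero hu
    filter_upwards [hnull] with v hv
    refine propext ⟨fun h => h.1, fun hm => ⟨hm, ?_⟩⟩
    obtain ⟨t, ht, h'⟩ := signedArea_of_mem_parallelepiped hm
    refine lt_of_le_of_ne ?_ hv.symm
    rw [h']
    exact mul_nonneg ht (by linarith)

theorem isClosed_setOf_segments_meet {ι : Type*} [TopologicalSpace ι] {a b c d : ι → Plane}
    (ha : Continuous a) (hb : Continuous b) (hc : Continuous c) (hd : Continuous d) :
    IsClosed {x | (segment ℝ (c x) (d x) ∩ segment ℝ (a x) (b x)).Nonempty} := by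
  have hcl : IsClosed {p : ι × (Icc (0 : ℝ) 1 × Icc (0 : ℝ) 1) |
      c p.1 + (p.2.1 : ℝ) • (d p.1 - c p.1) = a p.1 + (p.2.2 : ℝ) • (b p.1 - a p.1)} :=
    isClosed_eq (by fun_prop) (by fun_prop)
  convert isClosedMap_fst_of_compactSpace _ hcl using 1
  ext x
  simp only [segment_eq_image', mem_ofPred_eq, mem_image, Prod.exists]
  constructor
  · rintro ⟨_, ⟨t, ht, rfl⟩, s, hs, h⟩
    exact ⟨x, ⟨t, ht⟩, ⟨s, hs⟩, h.symm, rfl⟩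
  · rintro ⟨x, ⟨t, ht⟩, ⟨s, hs⟩, h, rfl⟩
    exact ⟨_, ⟨t, ht, rfl⟩, s, hs, h.symm⟩

theorem measurableSet_crossesFromLeft {ι : Type*} [MeasurableSpace ι] {a b c d : ι → Plane}
    (ha : Measurable a) (hb : Measurable b) (hc : Measurable c) (hd : Measurable d) :
    MeasurableSet {x | CrossesFromLeft (a x) (b x) (c x) (d x)} := by
  have hopen : IsOpen {p : Plane × Plane × Plane × Plane | p.2.2.1 ∈ Hplus p.1 p.2.1} := by
    simp only [Hplus, mem_ofPred_eq]
    exact isOpen_lt (by fun_prop) (by fun_prop)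
  have hclosed : IsClosed {p : Plane × Plane × Plane × Plane |
      (segment ℝ p.2.2.1 p.2.2.2 ∩ segment ℝ p.1 p.2.1).Nonempty} :=
    isClosed_setOf_segments_meet (by fun_prop) (by fun_prop) (by fun_prop) (by fun_prop)
  exact (ha.prodMk (hb.prodMk (hc.prodMk hd))) (hopen.measurableSet.inter hclosed.measurableSet)

theorem lintegral_euclidean_polar {f : Plane → ℝ≥0∞} (hf : Measurable f) :
    ∫⁻ w, f w = ∫⁻ r in Ioi (0 : ℝ), ∫⁻ θ in Ioo (-π) π,
      ENNReal.ofReal r * f !₂[r * cos θ, r * sin θ] := by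
  have h₁ : ∫⁻ w, f w = ∫⁻ p : ℝ × ℝ, f !₂[p.1, p.2] := by
    rw [← (PiLp.volume_preserving_toLp (Fin 2)).lintegral_comp hf,
      ← (volume_preserving_finTwoArrow ℝ).symm.lintegral_comp (by fun_prop)]
    rfl
  have hmeas : Measurable fun p : ℝ × ℝ =>
      ENNReal.ofReal p.1 * f !₂[p.1 * cos p.2, p.1 * sin p.2] := by
    refine Measurable.mul (by fun_prop) (hf.comp ?_)
    exact Continuous.measurable (by fun_prop)
  rw [h₁, ← lintegral_comp_polarCoord_symm, polarCoord_target, Measure.volume_eq_prod,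
    ← Measure.prod_restrict, lintegral_prod _ (by simpa using hmeas.aemeasurable)]
  simp

theorem norm_polar {r : ℝ} (hr : 0 ≤ r) (θ : ℝ) :
    ‖(!₂[r * cos θ, r * sin θ] : Plane)‖ = r := by
  rw [EuclideanSpace.norm_eq, Real.sqrt_eq_iff_mul_self_eq (by positivity) hr]
  simp [Fin.sum_univ_two]
  linear_combination r ^ 2 * Real.sin_sq_add_cos_sq θ

theorem lintegral_radial {F : ℝ → ℝ≥0∞} (hF : Measurable F) :
    ∫⁻ w : Plane, F ‖w‖ = 2 * ENNReal.ofReal π * ∫⁻ r in Ioi (0 : ℝ), ENNReal.ofReal r * F r := by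
  rw [lintegral_euclidean_polar (by fun_prop), ← lintegral_const_mul _ (by fun_prop)]
  refine setLIntegral_congr_fun measurableSet_Ioi fun r (hr : 0 < r) => ?_
  simp only [norm_polar hr.le, lintegral_const, Measure.restrict_apply_univ, Real.volume_Ioo]
  rw [sub_neg_eq_add, ← two_mul, ENNReal.ofReal_mul (by norm_num), ENNReal.ofReal_ofNat, mul_comm]

theorem integral_posPart_sin : ∫ θ in (-π)..π, max 0 (sin θ) = 2 := by
  have hc : Continuous fun θ => max 0 (sin θ) := by fun_prop
  rw [← intervalIntegral.integral_add_adjacent_intervals (b := 0)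
    (hc.intervalIntegrable _ _) (hc.intervalIntegrable _ _)]
  have h₁ : ∫ θ in (-π)..0, max 0 (sin θ) = ∫ θ in (-π)..0, (0 : ℝ) := by
    refine intervalIntegral.integral_congr fun θ hθ => ?_
    rw [uIcc_of_le (by linarith [pi_pos])] at hθ
    exact max_eq_left (sin_nonpos_of_nonpos_of_neg_pi_le hθ.2 hθ.1)
  have h₂ : ∫ θ in (0)..π, max 0 (sin θ) = ∫ θ in (0)..π, sin θ := by
    refine intervalIntegral.integral_congr fun θ hθ => ?_
    rw [uIcc_of_le pi_pos.le] at hθ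
    exact max_eq_right (sin_nonneg_of_nonneg_of_le_pi hθ.1 hθ.2)
  rw [h₁, h₂, integral_sin]
  norm_num

theorem lintegral_ofReal_sin_sub (φ : ℝ) :
    ∫⁻ θ in Ioo (-π) π, ENNReal.ofReal (sin (φ - θ)) = 2 := by
  have hper : Function.Periodic (fun θ => max 0 (sin θ)) (2 * π) := fun θ => by simp
  have hint : ∫ θ in (-π)..π, max 0 (sin (φ - θ)) = 2 := by
    rw [intervalIntegral.integral_comp_sub_left (fun θ => max 0 (sin θ)), ← integral_posPart_sin]
    convert hper.intervalIntegral_add_eq (φ - π) (-π) using 2 <;> ring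
  have hc : Continuous fun θ => max 0 (sin (φ - θ)) := by fun_prop
  rw [intervalIntegral.integral_of_le (by linarith [pi_pos]), integral_Ioc_eq_integral_Ioo] at hint
  rw [← ENNReal.ofReal_ofNat, ← hint, ofReal_integral_eq_lintegral_ofReal]
  · refine lintegral_congr fun θ => ?_
    simp
  · exact hc.integrableOn_Icc.mono_set Ioo_subset_Icc_self
  · exact Filter.Eventually.of_forall fun θ => le_max_left _ _

theorem lintegral_radial_mul_neg_signedArea {F : ℝ → ℝ≥0∞} (hF : Measurable F) (u : Plane) :
    ∫⁻ w, F ‖w‖ * ENNReal.ofReal (-signedArea u w) =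
      2 * ENNReal.ofReal ‖u‖ * ∫⁻ r in Ioi (0 : ℝ), ENNReal.ofReal (r ^ 2) * F r := by
  obtain ⟨φ, h₀, h₁⟩ : ∃ φ, u 0 = ‖u‖ * cos φ ∧ u 1 = ‖u‖ * sin φ := by
    have hn : ‖u‖ = ‖(⟨u 0, u 1⟩ : ℂ)‖ := by
      rw [EuclideanSpace.norm_eq, Complex.norm_eq_sqrt_sq_add_sq]
      simp [Fin.sum_univ_two]
    refine ⟨Complex.arg ⟨u 0, u 1⟩, ?_, ?_⟩
    · rw [hn, Complex.norm_mul_cos_arg]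
    · rw [hn, Complex.norm_mul_sin_arg]
  have hcont : Continuous fun w => -signedArea u w := by
    simp only [signedArea_apply]; fun_prop
  rw [lintegral_euclidean_polar
      (show Measurable fun w : Plane => F ‖w‖ * ENNReal.ofReal (-signedArea u w) from
        (hF.comp measurable_norm).mul hcont.measurable.ennreal_ofReal),
    ← lintegral_const_mul _ (by fun_prop)]
  refine setLIntegral_congr_fun measurableSet_Ioi fun r (hr : 0 < r) => ?_
  have harea (θ : ℝ) : -signedArea u !₂[r * cos θ, r * sin θ] = ‖u‖ * r * sin (φ - θ) := by
    simp [signedArea_apply, h₀, h₁, sin_sub]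
    ring
  simp only [norm_polar hr.le, harea]
  have : ∀ θ, ENNReal.ofReal r * (F r * ENNReal.ofReal (‖u‖ * r * sin (φ - θ))) =
      ENNReal.ofReal ‖u‖ * (ENNReal.ofReal (r ^ 2) * F r) * ENNReal.ofReal (sin (φ - θ)) := by
    intro θ
    rw [ENNReal.ofReal_mul (by positivity), ENNReal.ofReal_mul (by positivity),
      ENNReal.ofReal_pow hr.le]
    ring
  simp only [this]
  rw [lintegral_const_mul _ (by fun_prop), lintegral_ofReal_sin_sub]
  ring

theorem lintegral_crossing_segment {F : ℝ → ℝ≥0∞} (hF : Measurable F) (a b : Plane) :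
    ∫⁻ c, ∫⁻ d, F (dist d c) * (if CrossesFromLeft a b c d then 1 else 0) =
      2 * ENNReal.ofReal (dist b a) * ∫⁻ r in Ioi (0 : ℝ), ENNReal.ofReal (r ^ 2) * F r := by
  have htrans (c : Plane) : ∫⁻ d, F (dist d c) * (if CrossesFromLeft a b c d then 1 else 0) =
      ∫⁻ w, F ‖w‖ * (if CrossesFromLeft a b c (c + w) then 1 else 0) := by
    rw [← lintegral_add_left_eq_self _ c]
    simp
  have hset : MeasurableSet {p : Plane × Plane | CrossesFromLeft a b p.1 (p.1 + p.2)} :=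
    measurableSet_crossesFromLeft (by fun_prop) (by fun_prop) (by fun_prop) (by fun_prop)
  simp only [htrans]
  rw [lintegral_lintegral_swap
    ((by fun_prop : Measurable fun p : Plane × Plane => F ‖p.2‖).mul
      (Measurable.ite hset measurable_const measurable_const)).aemeasurable,
    dist_eq_norm, ← lintegral_radial_mul_neg_signedArea hF]
  refine lintegral_congr fun w => ?_
  have hw : MeasurableSet {c : Plane | CrossesFromLeft a b c (c + w)} :=
    measurableSet_crossesFromLeft (by fun_prop) (by fun_prop) (by fun_prop) (by fun_prop)
  rw [lintegral_const_mul _ (Measurable.ite hw measurable_const measurable_const),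
    ← volume_crossesFromLeft, ← lintegral_indicator_one hw]
  rfl

theorem lintegral_fin_cons {n : ℕ} {f : (Fin (n + 1) → Plane) → ℝ≥0∞} (hf : Measurable f) :
    ∫⁻ z, f z = ∫⁻ c, ∫⁻ z, f (Fin.cons c z) := by
  let e := MeasurableEquiv.piFinSuccAbove (fun _ : Fin (n + 1) => Plane) 0
  have he := (volume_preserving_piFinSuccAbove (fun _ : Fin (n + 1) => Plane) 0).symm e
  have hfe : Measurable fun p => f (e.symm p) := hf.comp e.symm.measurable
  rw [← he.lintegral_comp hf, Measure.volume_eq_prod, lintegral_prod _ hfe.aemeasurable]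
  refine lintegral_congr fun c => lintegral_congr fun z => ?_
  congr 1
  exact Fin.insertNth_zero' c z

/-- The sequence starting with `x, b`, followed by `z`, and then constantly zero. -/
def chainSeq {n : ℕ} (x b : Plane) (z : Fin n → Plane) : ℕ → Plane
  | 0 => x
  | 1 => b
  | k + 2 => if h : k < n then z ⟨k, h⟩ else 0

theorem chainSeq_cons_cons {n : ℕ} (x b c d : Plane) (z : Fin n → Plane) (k : ℕ) :
    chainSeq x b (Fin.cons c (Fin.cons d z : Fin (n + 1) → Plane) : Fin (n + 2) → Plane) (k + 2) =
      chainSeq c d z k := by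
  match k with
  | 0 => simp [chainSeq]
  | 1 =>
    simp only [chainSeq]
    rw [dif_pos (by omega)]
    rfl
  | k + 2 =>
    by_cases h : k < n
    · simp only [chainSeq, h, dif_pos, Nat.add_lt_add_iff_right]
      rfl
    · simp [chainSeq, h]

theorem measurable_chainSeq {n : ℕ} (x b : Plane) (k : ℕ) :
    Measurable fun z : Fin n → Plane => chainSeq x b z k := by
  match k with
  | 0 => exact measurable_const
  | 1 => exact measurable_const
  | k + 2 =>
    by_cases h : k < n
    · simpa [chainSeq, h] using measurable_pi_apply _
    · simp [chainSeq, h]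

/-- The weight of a chain of `m` crossings, without the factor of its first segment. -/
noncomputable def chainWeight (g : ℝ → ℝ≥0∞) (m : ℕ) (y : ℕ → Plane) : ℝ≥0∞ :=
  ∏ i ∈ Finset.range m, (g (dist (y (2 * i + 3)) (y (2 * i + 2))) *
    if CrossesFromLeft (y (2 * i)) (y (2 * i + 1)) (y (2 * i + 2)) (y (2 * i + 3)) then 1 else 0)

theorem chainWeight_succ (g : ℝ → ℝ≥0∞) (m : ℕ) (y : ℕ → Plane) :
    chainWeight g (m + 1) y = (g (dist (y 3) (y 2)) *
      if CrossesFromLeft (y 0) (y 1) (y 2) (y 3) then 1 else 0) *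
        chainWeight g m fun k => y (k + 2) := by
  rw [chainWeight, Finset.prod_range_succ', mul_comm]
  rfl

theorem measurable_chainWeight {g : ℝ → ℝ≥0∞} (hg : Measurable g) (m : ℕ) {ι : Type*}
    [MeasurableSpace ι] {y : ι → ℕ → Plane} (hy : ∀ k, Measurable fun x => y x k) :
    Measurable fun x => chainWeight g m (y x) :=
  Finset.measurable_fun_prod _ fun _ _ => (hg.comp ((hy _).dist (hy _))).mul <|
    Measurable.ite (measurableSet_crossesFromLeft (hy _) (hy _) (hy _) (hy _))
      measurable_const measurable_const

/-- The integral of `chainWeight g m` over all chains whose first segment has length `r`. -/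
noncomputable def chainValue (g : ℝ → ℝ≥0∞) : ℕ → ℝ → ℝ≥0∞
  | 0 => fun _ => 1
  | m + 1 => fun r => 2 * ENNReal.ofReal r *
      ∫⁻ s in Ioi (0 : ℝ), ENNReal.ofReal (s ^ 2) * (g s * chainValue g m s)

theorem measurable_chainValue (g : ℝ → ℝ≥0∞) (m : ℕ) : Measurable (chainValue g m) := by
  cases m <;> unfold chainValue <;> fun_prop

theorem lintegral_chainWeight {g : ℝ → ℝ≥0∞} (hg : Measurable g) (m : ℕ) (x b : Plane) :
    ∫⁻ z : Fin (2 * m) → Plane, chainWeight g m (chainSeq x b z) = chainValue g m (dist b x) := by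
  induction m generalizing x b with
  | zero => simp [chainWeight, chainValue, volume_pi]
  | succ m ih =>
    have hmeas : Measurable fun z : Fin (2 * m + 1 + 1) → Plane =>
        chainWeight g (m + 1) (chainSeq x b z) :=
      measurable_chainWeight hg _ (measurable_chainSeq x b)
    have hcons (c : Plane) : Measurable fun z : Fin (2 * m + 1) → Plane =>
        chainWeight g (m + 1) (chainSeq x b (Fin.cons c z : Fin (2 * m + 1 + 1) → Plane)) := by
      refine hmeas.comp (measurable_pi_lambda _ fun i => ?_)
      refine Fin.cases ?_ (fun i => ?_) i
      · exact measurable_const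
      · exact measurable_pi_apply i
    have hsplit (c d : Plane) : ∫⁻ z : Fin (2 * m) → Plane, chainWeight g (m + 1) (chainSeq x b
        (Fin.cons c (Fin.cons d z : Fin (2 * m + 1) → Plane) : Fin (2 * m + 1 + 1) → Plane)) =
        g (dist d c) * chainValue g m (dist d c) *
          if CrossesFromLeft x b c d then 1 else 0 := by
      rw [mul_right_comm, ← ih c d, ← lintegral_const_mul _
        (measurable_chainWeight hg _ (measurable_chainSeq c d))]
      refine lintegral_congr fun z => ?_
      rw [chainWeight_succ]
      simp only [chainSeq_cons_cons]
      rfl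
    calc ∫⁻ z : Fin (2 * m + 1 + 1) → Plane, chainWeight g (m + 1) (chainSeq x b z)
        = ∫⁻ c, ∫⁻ d, g (dist d c) * chainValue g m (dist d c) *
            if CrossesFromLeft x b c d then 1 else 0 := by
          rw [lintegral_fin_cons hmeas]
          refine lintegral_congr fun c => ?_
          rw [lintegral_fin_cons (hcons c)]
          exact lintegral_congr fun d => hsplit c d
      _ = chainValue g (m + 1) (dist b x) :=
          lintegral_crossing_segment (F := fun r => g r * chainValue g m r)
            (hg.mul (measurable_chainValue g m)) x b

theorem chainValue_succ {g : ℝ → ℝ≥0∞} (hg : Measurable g) (m : ℕ) (r : ℝ) :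
    chainValue g (m + 1) r = 2 ^ (m + 1) * ENNReal.ofReal r *
      (∫⁻ r in Ioi (0 : ℝ), ENNReal.ofReal (r ^ 2) * g r) *
      (∫⁻ r in Ioi (0 : ℝ), ENNReal.ofReal (r ^ 3) * g r) ^ m := by
  induction m generalizing r with
  | zero => simp [chainValue]
  | succ m ih =>
    rw [chainValue]
    simp only [ih]
    generalize ∫⁻ r in Ioi (0 : ℝ), ENNReal.ofReal (r ^ 2) * g r = G
    have h : ∀ s ∈ Ioi (0 : ℝ), ENNReal.ofReal (s ^ 2) * (g s * (2 ^ (m + 1) * ENNReal.ofReal s *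
        G * (∫⁻ r in Ioi (0 : ℝ), ENNReal.ofReal (r ^ 3) * g r) ^ m)) =
        2 ^ (m + 1) * G * (∫⁻ r in Ioi (0 : ℝ), ENNReal.ofReal (r ^ 3) * g r) ^ m *
          (ENNReal.ofReal (s ^ 3) * g s) := by
      intro s hs
      rw [ENNReal.ofReal_pow (le_of_lt hs), ENNReal.ofReal_pow (le_of_lt hs)]
      ring
    rw [setLIntegral_congr_fun measurableSet_Ioi h, lintegral_const_mul _ (by fun_prop)]
    ring

/-- Fix `m ≥ 1` and measurable `g : [0,∞) → [0,∞]`. With `y₁ = 0`,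
the iterated Lebesgue integral over `(y₂, …, y_{2m+2}) ∈ (Plane)^{2m+1}` of
`∏_{i=1}^{m+1} g(|y_{2i} − y_{2i−1}|) · ∏_{i=1}^{m} 1{ y_{2i+1} ∈ H⁺(y_{2i−1}, y_{2i})
and [y_{2i+1}, y_{2i+2}] ∩ [y_{2i−1}, y_{2i}] ≠ ∅ }` equals
`2^{m+1} π (∫_0^∞ r² g(r) dr)² (∫_0^∞ r³ g(r) dr)^{m−1}`.
Here `y j` (for `j = 0, …, 2m+1`) denotes the paper's `y_{j+1}`. -/
theorem stmt2 (m : ℕ) (hm : 1 ≤ m) (g : ℝ → ℝ≥0∞) (hg : Measurable g) :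
    ∫⁻ z : Fin (2 * m + 1) → EuclideanSpace ℝ (Fin 2),
      (fun y : ℕ → EuclideanSpace ℝ (Fin 2) =>
          (∏ i ∈ Finset.range (m + 1), g (dist (y (2 * i + 1)) (y (2 * i)))) *
            ∏ j ∈ Finset.range m,
              (if y (2 * j + 2) ∈ Hplus (y (2 * j)) (y (2 * j + 1)) ∧
                    (segment ℝ (y (2 * j + 2)) (y (2 * j + 3)) ∩
                        segment ℝ (y (2 * j)) (y (2 * j + 1))).Nonempty
                then (1 : ℝ≥0∞) else 0))
        (fun n => if h : 1 ≤ n ∧ n - 1 < 2 * m + 1 then z ⟨n - 1, h.2⟩ else 0) =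
      (2 : ℝ≥0∞) ^ (m + 1) * ENNReal.ofReal π *
        (∫⁻ r in Set.Ioi (0 : ℝ), ENNReal.ofReal (r ^ 2) * g r) ^ 2 *
        (∫⁻ r in Set.Ioi (0 : ℝ), ENNReal.ofReal (r ^ 3) * g r) ^ (m - 1) := by
  have hseq (z : Fin (2 * m + 1) → Plane) :
      (fun n => if h : 1 ≤ n ∧ n - 1 < 2 * m + 1 then z ⟨n - 1, h.2⟩ else 0) =
        chainSeq 0 (z 0) (Fin.tail z) := by
    funext n
    match n with
    | 0 => rfl
    | 1 => simp [chainSeq]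
    | n + 2 =>
      by_cases h : n < 2 * m
      · simp [chainSeq, h, Fin.tail]
      · simp [chainSeq, h]
  have hweight (y : ℕ → Plane) :
      (∏ i ∈ Finset.range (m + 1), g (dist (y (2 * i + 1)) (y (2 * i)))) *
        ∏ j ∈ Finset.range m, (if y (2 * j + 2) ∈ Hplus (y (2 * j)) (y (2 * j + 1)) ∧
          (segment ℝ (y (2 * j + 2)) (y (2 * j + 3)) ∩
            segment ℝ (y (2 * j)) (y (2 * j + 1))).Nonempty then (1 : ℝ≥0∞) else 0) =
      g (dist (y 1) (y 0)) * chainWeight g m y := by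
    rw [chainWeight, Finset.prod_mul_distrib, Finset.prod_range_succ',
      mul_comm (Finset.prod _ _) (g _), mul_assoc]
    congr 2
    refine Finset.prod_congr rfl fun j _ => ?_
    unfold CrossesFromLeft
    congr
  have hmeas : Measurable fun z : Fin (2 * m + 1) → Plane =>
      g (dist (z 0) 0) * chainWeight g m (chainSeq 0 (z 0) (Fin.tail z)) := by
    refine Measurable.mul (by fun_prop) (measurable_chainWeight hg m fun k => ?_)
    simp only [← hseq]
    by_cases h : 1 ≤ k ∧ k - 1 < 2 * m + 1
    · simpa only [dif_pos h] using measurable_pi_apply _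
    · simp only [dif_neg h, measurable_const]
  have hfirst : ∫⁻ z : Fin (2 * m + 1) → Plane,
      g (dist (z 0) 0) * chainWeight g m (chainSeq 0 (z 0) (Fin.tail z)) =
      ∫⁻ b : Plane, g ‖b‖ * chainValue g m ‖b‖ := by
    rw [lintegral_fin_cons hmeas]
    refine lintegral_congr fun b => ?_
    simp only [Fin.cons_zero, Fin.tail_cons]
    rw [lintegral_const_mul _ (measurable_chainWeight hg m (measurable_chainSeq 0 b)),
      lintegral_chainWeight hg, dist_zero_right]
  refine ((lintegral_congr fun z => ?_).trans hfirst).trans ?_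
  · rw [hseq]
    exact hweight _
  rw [lintegral_radial (F := fun r => g r * chainValue g m r)
    (hg.mul (measurable_chainValue g m))]
  obtain ⟨k, rfl⟩ := Nat.exists_eq_add_of_le' hm
  have hvalue := chainValue_succ hg k
  simp only [hvalue, Nat.add_sub_cancel]
  generalize (∫⁻ r in Ioi (0 : ℝ), ENNReal.ofReal (r ^ 3) * g r) ^ k = B
  have h : ∀ r ∈ Ioi (0 : ℝ), ENNReal.ofReal r * (g r * (2 ^ (k + 1) * ENNReal.ofReal r *
      (∫⁻ r in Ioi (0 : ℝ), ENNReal.ofReal (r ^ 2) * g r) * B)) =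
      2 ^ (k + 1) * (∫⁻ r in Ioi (0 : ℝ), ENNReal.ofReal (r ^ 2) * g r) * B *
        (ENNReal.ofReal (r ^ 2) * g r) := by
    intro r hr
    rw [ENNReal.ofReal_pow (le_of_lt hr)]
    ring
  rw [setLIntegral_congr_fun measurableSet_Ioi h, lintegral_const_mul _ (by fun_prop)]
  ring
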